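/- Let (P,C) be a bicolored poset with n elements, let ω : P → {1,…,n} be a bijective labeling, and let L : a_1 ≺_L ⋯ ≺_L a_n be a linear extension of P with associated word ω_L. Let ω̄ be the complementary labeling defined by ω̄(a) = n+1−ω(a), and let ω̄_L = ω̄(a_1)ω̄(a_2)⋯ω̄(a_n) be the word of L under ω̄. Let p°, p ∈ ℚ[X,Y] be polynomials such that Ω°_{ω_L}(x,y) = p°(x,y) and Ω_{ω̄_L}(x,y) = p(x,y) for all integers x and y with x ≥ 1 and 0 ≤ y ≤ x. Then (−1)^n · p°(−X,−Y) = p(X, Y+1) as an identity of polynomials in ℚ[X,Y]. -/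

import Mathlib

/-- Number of type-`ω_L` maps `φ` with `1 ≤ φ ≤ x`, weak inequalities at ascents of the
word (positions `i` with `ω(a i) < ω(a (i+1))`), strict inequalities at descents, and
`φ(c) > y` for all celeste `c`. -/
noncomputable def typeMapsStrict {P : Type} (n : ℕ) (ω : P → ℕ) (a : Fin n ≃ P)
    (C : Finset P) (x y : ℤ) : ℕ :=
  Nat.card {φ : P → ℤ //
    (∀ v, 1 ≤ φ v ∧ φ v ≤ x) ∧
    (∀ i j : Fin n, (i : ℕ) + 1 = (j : ℕ) →
      if ω (a i) < ω (a j) then φ (a i) ≤ φ (a j) else φ (a i) < φ (a j)) ∧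
    (∀ c ∈ C, y < φ c)}

/-- Number of type-`ω_L` maps `φ` with `1 ≤ φ ≤ x`, weak inequalities at ascents, strict
inequalities at descents, and `φ(c) ≥ y` for all celeste `c`. -/
noncomputable def typeMapsWeak {P : Type} (n : ℕ) (ω : P → ℕ) (a : Fin n ≃ P)
    (C : Finset P) (x y : ℤ) : ℕ :=
  Nat.card {φ : P → ℤ //
    (∀ v, 1 ≤ φ v ∧ φ v ≤ x) ∧
    (∀ i j : Fin n, (i : ℕ) + 1 = (j : ℕ) →
      if ω (a i) < ω (a j) then φ (a i) ≤ φ (a j) else φ (a i) < φ (a j)) ∧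
    (∀ c ∈ C, y ≤ φ c)}

open MvPolynomial in
theorem MvPolynomial.eval_aeval_pair (r s t : MvPolynomial (Fin 2) ℚ) (v : Fin 2 → ℚ) :
    eval v (aeval ![s, t] r) = eval ![eval v s, eval v t] r := by
  rw [← MvPolynomial.coe_aeval_eq_eval, RingHom.coe_coe, ← AlgHom.comp_apply, comp_aeval,
    ← MvPolynomial.coe_aeval_eq_eval, RingHom.coe_coe]
  congr 2
  ext i
  fin_cases i <;> simp

open MvPolynomial in
/-- Every polynomial is the backward difference, in the first variable, of a polynomial. -/
theorem MvPolynomial.exists_eval_sub_eval_sub_one (f : MvPolynomial (Fin 2) ℚ) :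
    ∃ g : MvPolynomial (Fin 2) ℚ, ∀ x y : ℚ,
      eval ![x, y] g - eval ![x - 1, y] g = eval ![x, y] f := by
  induction f using MvPolynomial.induction_on' with
  | monomial u c =>
    refine ⟨C (c / (u 0 + 1)) * X 1 ^ u 1 *
      Polynomial.aeval (X 0 + 1) (Polynomial.bernoulli (u 0 + 1)), fun x y => ?_⟩
    have key (t : ℚ) : eval ![t, y]
        (Polynomial.aeval (X 0 + 1 : MvPolynomial (Fin 2) ℚ) (Polynomial.bernoulli (u 0 + 1)))
        = (Polynomial.bernoulli (u 0 + 1)).eval (1 + t) := by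
      rw [← MvPolynomial.coe_aeval_eq_eval, RingHom.coe_coe,
        ← Polynomial.aeval_algHom_apply, Polynomial.coe_aeval_eq_eval]
      simp [add_comm]
    have hb := Polynomial.bernoulli_eval_one_add (u 0 + 1) x
    have hu : ((u 0 : ℚ) + 1) ≠ 0 := by positivity
    have h1 : 1 + (x - 1) = x := by ring
    simp only [map_mul, key, eval_C, map_pow, eval_X, eval_monomial, Finsupp.prod_fintype,
      pow_zero, implies_true, Fin.prod_univ_two, h1, hb]
    simp
    field_simp
    ring
  | add p q hp hq =>
    obtain ⟨g, hg⟩ := hp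
    obtain ⟨h, hh⟩ := hq
    refine ⟨g + h, fun x y => ?_⟩
    rw [map_add, map_add, map_add, ← hg, ← hh]
    ring

open MvPolynomial in
/-- Bivariate polynomials agreeing at the integer points with `0 ≤ y < x` are equal. -/
theorem MvPolynomial.eq_of_eval_eq_on_int_cone {p q : MvPolynomial (Fin 2) ℚ}
    (h : ∀ x y : ℤ, 0 ≤ y → y < x → eval ![(x : ℚ), (y : ℚ)] p = eval ![(x : ℚ), (y : ℚ)] q) :
    p = q := by
  have hcomp : aeval ![X 0 + X 1 + 1, (X 1 : MvPolynomial (Fin 2) ℚ)] p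
      = aeval ![X 0 + X 1 + 1, (X 1 : MvPolynomial (Fin 2) ℚ)] q := by
    refine MvPolynomial.funext_set (fun _ => Set.range ((↑) : ℕ → ℚ))
      (fun _ => Set.infinite_range_of_injective Nat.cast_injective) fun v hv => ?_
    obtain ⟨k, hk⟩ := hv 0 trivial
    obtain ⟨l, hl⟩ := hv 1 trivial
    simp only [eval_aeval_pair, map_add, map_one, eval_X, ← hk, ← hl]
    simpa using h (k + l + 1) l (by positivity) (by lia)
  refine MvPolynomial.funext fun v => ?_
  have := congrArg (eval ![v 0 - v 1 - 1, v 1]) hcomp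
  have hv : ![v 0, v 1] = v := by ext i; fin_cases i <;> rfl
  simpa only [eval_aeval_pair, map_add, map_one, eval_X, Matrix.cons_val_zero,
    Matrix.cons_val_one, sub_add_cancel, show v 0 - v 1 - 1 + v 1 + 1 = v 0 by ring, hv] using this

/-- Sequences of length `m` in `{1, …, x}` that grow by at least `d j` when passing to position
`j`, and exceed `y` at the positions marked by `c`. -/
def markedChains (c : ℕ → Prop) (d : ℕ → ℤ) (m : ℕ) (x y : ℤ) : Set (Fin m → ℤ) :=
  {φ | (∀ i, 1 ≤ φ i ∧ φ i ≤ x) ∧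
    (∀ i j : Fin m, (i : ℕ) + 1 = (j : ℕ) → φ i + d j ≤ φ j) ∧
    (∀ i : Fin m, c i → y < φ i)}

namespace markedChains

variable {c : ℕ → Prop} {d : ℕ → ℤ} {m : ℕ} {x y : ℤ}

theorem finite : (markedChains c d m x y).Finite :=
  (Set.Finite.pi' fun _ => Set.finite_Icc 1 x).subset fun _ hφ i => hφ.1 i

theorem monotone (hd : ∀ j, 0 ≤ d j) {φ : Fin m → ℤ} (hφ : φ ∈ markedChains c d m x y) :
    Monotone φ := by
  cases m with
  | zero => exact fun i => i.elim0
  | succ m =>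
    refine Fin.monotone_iff_le_succ.2 fun i => ?_
    have := hφ.2.1 i.castSucc i.succ (by simp)
    linarith [hd i.succ]

/-- The least value of `x` for which `ncard_eq` below computes the number of chains. -/
noncomputable def start (c : ℕ → Prop) (m : ℕ) (y : ℤ) : ℤ :=
  open Classical in if ∃ i < m, c i then y else 0

theorem start_mono (hy : 0 ≤ y) : start c m y ≤ start c (m + 1) y := by
  unfold start
  split_ifs with h h' h'
  · exact le_rfl
  · obtain ⟨i, hi, hc⟩ := h
    exact (h' ⟨i, by lia, hc⟩).elim
  · exact hy
  · exact le_rfl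

theorem start_nonneg (hy : 0 ≤ y) : 0 ≤ start c m y := by
  unfold start
  split_ifs <;> simp [hy]

theorem start_le (hy : 0 ≤ y) : start c m y ≤ y := by
  unfold start
  split_ifs <;> simp [hy]

theorem ncard_zero : (markedChains c d 0 x y).ncard = 1 := by
  rw [Set.ncard_eq_one]
  refine ⟨Fin.elim0, Set.eq_singleton_iff_unique_mem.2 ⟨?_, fun _ _ => Subsingleton.elim _ _⟩⟩
  exact ⟨fun i => i.elim0, fun i => i.elim0, fun i => i.elim0⟩

theorem ncard_start : (markedChains c d (m + 1) (start c (m + 1) y) y).ncard = 0 := by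
  rw [Set.ncard_eq_zero finite, Set.eq_empty_iff_forall_notMem]
  rintro φ ⟨h1, -, h3⟩
  unfold start at h1
  split_ifs at h1 with h
  · obtain ⟨i, hi, hc⟩ := h
    have := h3 ⟨i, hi⟩ hc
    have := h1 ⟨i, hi⟩
    lia
  · have := h1 0
    lia

theorem eq_union (hd : ∀ j, 0 ≤ d j) (hy : 0 ≤ y) (hx : start c (m + 1) y < x) :
    markedChains c d (m + 1) x y = markedChains c d (m + 1) (x - 1) y ∪
      (fun ψ : Fin m → ℤ => (Fin.snoc ψ x : Fin (m + 1) → ℤ)) ''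
        markedChains c d m (x - d m) y := by
  ext φ
  constructor
  · intro hφ
    have hmono := monotone hd hφ
    obtain ⟨h1, h2, h3⟩ := hφ
    rcases (h1 (Fin.last m)).2.lt_or_eq with hlt | heq
    · left
      refine ⟨fun i => ⟨(h1 i).1, ?_⟩, h2, h3⟩
      have := hmono (Fin.le_last i)
      lia
    · right
      refine ⟨Fin.init φ, ⟨fun i => ⟨(h1 i.castSucc).1, ?_⟩,
        fun i j hij => h2 i.castSucc j.castSucc hij, fun i hi => h3 i.castSucc hi⟩, ?_⟩
      · obtain _ | m := m
        · exact i.elim0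
        · have h4 := h2 (Fin.last m).castSucc (Fin.last (m + 1)) (by simp)
          have h5 : φ i.castSucc ≤ φ (Fin.last m).castSucc :=
            hmono (Fin.castSucc_le_castSucc_iff.2 (Fin.le_last i))
          simp only [Fin.val_last] at h4
          simp only [Fin.init]
          lia
      · simp only [← heq, Fin.snoc_init_self]
  · rintro (⟨h1, h2, h3⟩ | ⟨ψ, ⟨h1, h2, h3⟩, rfl⟩)
    · exact ⟨fun i => ⟨(h1 i).1, by linarith [(h1 i).2]⟩, h2, h3⟩
    · have h0 := start_nonneg (c := c) (m := m + 1) hy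
      refine ⟨fun i => ?_, fun i j hij => ?_, fun i hi => ?_⟩
      · refine Fin.lastCases ?_ (fun i => ?_) i
        · simp only [Fin.snoc_last]
          lia
        · simp only [Fin.snoc_castSucc]
          have := h1 i
          have := hd m
          lia
      · induction i using Fin.lastCases with
        | last => have := j.2; simp at hij; lia
        | cast i =>
          induction j using Fin.lastCases with
          | last =>
            have := h1 i
            simp only [Fin.snoc_castSucc, Fin.snoc_last, Fin.val_last]
            lia
          | cast j =>
            simp only [Fin.snoc_castSucc]
            exact h2 i j hij
      · induction i using Fin.lastCases with
        | last =>
          simp only [Fin.snoc_last]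
          have : start c (m + 1) y = y := if_pos ⟨m, by lia, hi⟩
          lia
        | cast i =>
          simp only [Fin.snoc_castSucc]
          exact h3 i hi

theorem ncard_succ (hd : ∀ j, 0 ≤ d j) (hy : 0 ≤ y) (hx : start c (m + 1) y < x) :
    (markedChains c d (m + 1) x y).ncard = (markedChains c d (m + 1) (x - 1) y).ncard +
      (markedChains c d m (x - d m) y).ncard := by
  rw [eq_union hd hy hx, Set.ncard_union_eq ?_ finite (finite.image _), Set.ncard_image_of_injective]
  · intro ψ ψ' h
    simpa using congrArg Fin.init h
  · rw [Set.disjoint_left]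
    rintro _ ⟨h1, -, -⟩ ⟨ψ, -, rfl⟩
    have := (h1 (Fin.last m)).2
    simp only [Fin.snoc_last] at this
    lia

/-- A function with the right initial value and differences counts the chains. -/
theorem ncard_eq_of_sub (hd : ∀ j, 0 ≤ d j) (hy : 0 ≤ y) {H : ℤ → ℚ}
    (h0 : H (start c (m + 1) y) = 0)
    (hsub : ∀ x, start c (m + 1) y < x →
      H x - H (x - 1) = (markedChains c d m (x - d m) y).ncard)
    (hx : start c (m + 1) y ≤ x) : ((markedChains c d (m + 1) x y).ncard : ℚ) = H x := by
  induction x, hx using Int.leInduction with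
  | base => rw [ncard_start, h0, Nat.cast_zero]
  | succ x hx ih =>
    have := hsub (x + 1) (by lia)
    rw [ncard_succ hd hy (by lia), Nat.cast_add, ← this, add_sub_cancel_right, ih]
    ring

open MvPolynomial in
/-- The number of chains is a polynomial in `(x, y)`, whose reflection counts the chains
for the complementary step sequence. -/
theorem exists_polynomial (c : ℕ → Prop) (d : ℕ → ℤ) (hd : ∀ j, 0 ≤ d j ∧ d j ≤ 1) (m : ℕ) :
    ∃ F : MvPolynomial (Fin 2) ℚ, ∀ x y : ℤ, 0 ≤ y → start c m y ≤ x →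
      ((markedChains c d m x y).ncard : ℚ) = eval ![(x : ℚ), (y : ℚ)] F ∧
      ((markedChains c (fun j => 1 - d j) m x y).ncard : ℚ)
        = (-1) ^ m * eval ![-(x : ℚ), -(y : ℚ)] F := by
  induction m with
  | zero => exact ⟨1, fun x y _ _ => by simp [ncard_zero]⟩
  | succ m ih =>
    obtain ⟨F, hF⟩ := ih
    obtain ⟨g, hg⟩ := exists_eval_sub_eval_sub_one
      (aeval ![X 0 - C (d m : ℚ), (X 1 : MvPolynomial (Fin 2) ℚ)] F)
    simp only [eval_aeval_pair, map_sub, eval_X, eval_C, Matrix.cons_val_zero, Matrix.cons_val_one] at hg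
    classical
    set s : MvPolynomial (Fin 2) ℚ := if ∃ i < m + 1, c i then X 1 else 0 with hs
    have hstart (y : ℤ) (u : ℚ) : eval ![u, (y : ℚ)] s = (start c (m + 1) y : ℤ) := by
      rw [hs]
      unfold start
      split_ifs <;> simp
    have hstart' (y : ℤ) (u : ℚ) : eval ![u, -(y : ℚ)] s = -(start c (m + 1) y : ℤ) := by
      rw [hs]
      unfold start
      split_ifs <;> simp
    refine ⟨g - aeval ![s, X 1] g, fun x y hy hx => ⟨?_, ?_⟩⟩
    · refine ncard_eq_of_sub (H := fun x : ℤ => eval ![(x : ℚ), (y : ℚ)] (g - aeval ![s, X 1] g))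
        (fun j => (hd j).1) hy ?_ (fun x hx => ?_) hx
      · simp only [map_sub, eval_aeval_pair, hstart, eval_X, Matrix.cons_val_one,
          Matrix.cons_val_fin_one, sub_self]
      · have h1 := hg x y
        have := start_mono (c := c) (m := m) hy
        have := hd m
        rw [(hF (x - d m) y hy (by lia)).1]
        simp only [map_sub, eval_aeval_pair, hstart, eval_X, Matrix.cons_val_one]
        push_cast
        rw [← h1]
        ring
    · refine ncard_eq_of_sub (H := fun x : ℤ => (-1) ^ (m + 1) *
          eval ![-(x : ℚ), -(y : ℚ)] (g - aeval ![s, X 1] g))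
        (fun j => by linarith [(hd j).2]) hy ?_ (fun x hx => ?_) hx
      · simp only [map_sub, eval_aeval_pair, hstart', eval_X, Matrix.cons_val_one,
          Matrix.cons_val_fin_one, sub_self, mul_zero]
      · have h1 := hg (-x + 1) (-y)
        have := start_mono (c := c) (m := m) hy
        have := hd m
        rw [(hF (x - (1 - d m)) y hy (by lia)).2]
        simp only [map_sub, eval_aeval_pair, hstart', eval_X, Matrix.cons_val_one]
        push_cast
        rw [show -((x : ℚ) - (1 - d m)) = -x + 1 - d m by ring, ← h1,
          show -((x : ℚ) - 1) = -x + 1 by ring, show -(x : ℚ) + 1 - 1 = -x by ring]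
        ring

theorem card_subtype_eq_ncard {P : Type} (a : Fin m ≃ P) {S : (P → ℤ) → Prop}
    (hS : ∀ φ : P → ℤ, S φ ↔ φ ∘ a ∈ markedChains c d m x y) :
    Nat.card {φ // S φ} = (markedChains c d m x y).ncard :=
  Nat.card_congr ((a.symm.arrowCongr (Equiv.refl ℤ)).subtypeEquiv fun φ => hS φ)

end markedChains

/-- The least increment forced at position `j` by the word of `ω` along `a`. -/
noncomputable def descentStep {P : Type} {n : ℕ} (ω : P → ℕ) (a : Fin n ≃ P) (j : ℕ) : ℤ :=
  open Classical in
  if ∃ i k : Fin n, (i : ℕ) + 1 = j ∧ (k : ℕ) = j ∧ ω (a i) < ω (a k) then 0 else 1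

theorem descentStep_eq {P : Type} {n : ℕ} (ω : P → ℕ) (a : Fin n ≃ P) {i j : Fin n}
    (hij : (i : ℕ) + 1 = j) : descentStep ω a j = if ω (a i) < ω (a j) then 0 else 1 := by
  unfold descentStep
  congr 1
  refine propext ⟨?_, fun h => ⟨i, j, hij, rfl, h⟩⟩
  rintro ⟨i', j', hi, hj, h⟩
  obtain rfl : i' = i := Fin.ext (by lia)
  obtain rfl : j' = j := Fin.ext hj
  exact h

theorem typeMapsStrict_eq_ncard {P : Type} {n : ℕ} (ω : P → ℕ) (a : Fin n ≃ P) (C : Finset P)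
    (d : ℕ → ℤ) (hd : ∀ i j : Fin n, (i : ℕ) + 1 = j →
      d j = if ω (a i) < ω (a j) then 0 else 1) (x y : ℤ) :
    typeMapsStrict n ω a C x y =
      (markedChains (fun i => ∃ k : Fin n, (k : ℕ) = i ∧ a k ∈ C) d n x y).ncard := by
  refine markedChains.card_subtype_eq_ncard a fun φ => and_congr ?_ (and_congr ?_ ?_)
  · exact a.forall_congr_right.symm
  · refine forall₃_congr fun i j hij => ?_
    rw [hd i j hij]
    split_ifs <;> simp
  · constructor
    · rintro h i ⟨k, hk, hkC⟩
      obtain rfl := Fin.ext hk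
      exact h _ hkC
    · intro h v hv
      simpa using h (a.symm v) ⟨a.symm v, rfl, by simpa using hv⟩

theorem typeMapsWeak_add_one {P : Type} (n : ℕ) (ω : P → ℕ) (a : Fin n ≃ P) (C : Finset P)
    (x y : ℤ) : typeMapsWeak n ω a C x (y + 1) = typeMapsStrict n ω a C x y := rfl

/-- Let `(P,C)` be a bicolored poset with `n` elements, `ω : P → {1,…,n}`
a bijective labeling, `L : a_1 ≺_L ⋯ ≺_L a_n` a linear extension of `P` (here
`a : Fin n ≃ P` with `a i ≤_P a j → i ≤ j`), and `ω̄ = n + 1 - ω` the complementary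
labeling.  If `p°, p ∈ ℚ[X,Y]` compute `Ω°_{ω_L}` and `Ω_{ω̄_L}` respectively for all
integers `x ≥ 1`, `0 ≤ y ≤ x`, then `(-1)^n p°(-X,-Y) = p(X,Y+1)` as polynomials. -/
theorem stmt_8 (P : Type) [Fintype P] [PartialOrder P] (n : ℕ)
    (hcard : Fintype.card P = n) (C : Finset P)
    (ω : P → ℕ) (hω1 : ∀ v, ω v ∈ Finset.Icc 1 n) (hω2 : Function.Injective ω)
    (a : Fin n ≃ P) (hext : ∀ i j : Fin n, a i ≤ a j → i ≤ j)
    (pstrict pweak : MvPolynomial (Fin 2) ℚ)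
    (hstrict : ∀ x y : ℤ, 1 ≤ x → 0 ≤ y → y ≤ x →
      (typeMapsStrict n ω a C x y : ℚ) = MvPolynomial.eval ![(x : ℚ), (y : ℚ)] pstrict)
    (hweak : ∀ x y : ℤ, 1 ≤ x → 0 ≤ y → y ≤ x →
      (typeMapsWeak n (fun v => n + 1 - ω v) a C x y : ℚ)
        = MvPolynomial.eval ![(x : ℚ), (y : ℚ)] pweak) :
    (-1 : MvPolynomial (Fin 2) ℚ) ^ n *
        MvPolynomial.aeval ![-MvPolynomial.X 0, -MvPolynomial.X 1] pstrict
      = MvPolynomial.aeval ![MvPolynomial.X 0, MvPolynomial.X 1 + 1] pweak := by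
  let c : ℕ → Prop := fun i => ∃ k : Fin n, (k : ℕ) = i ∧ a k ∈ C
  obtain ⟨F, hF⟩ := markedChains.exists_polynomial c (descentStep ω a)
    (fun j => by unfold descentStep; split_ifs <;> simp) n
  have hcompl : ∀ i j : Fin n, (i : ℕ) + 1 = j → 1 - descentStep ω a j =
      if n + 1 - ω (a i) < n + 1 - ω (a j) then 0 else 1 := by
    intro i j hij
    rw [descentStep_eq ω a hij]
    have hi := Finset.mem_Icc.1 (hω1 (a i))
    have hj := Finset.mem_Icc.1 (hω1 (a j))
    have hne : ω (a i) ≠ ω (a j) := fun h => by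
      have := a.injective (hω2 h)
      subst this
      lia
    split_ifs <;> lia
  have hpF : pstrict = F := MvPolynomial.eq_of_eval_eq_on_int_cone fun x y hy hyx => by
    rw [← hstrict x y (by lia) hy hyx.le,
      typeMapsStrict_eq_ncard ω a C _ (fun i j => descentStep_eq ω a)]
    exact (hF x y hy ((markedChains.start_le hy).trans hyx.le)).1
  refine MvPolynomial.eq_of_eval_eq_on_int_cone fun x y hy hyx => ?_
  have h1 := (hF x y hy ((markedChains.start_le hy).trans hyx.le)).2
  have h2 := hweak x (y + 1) (by lia) (by lia) (by lia)
  rw [typeMapsWeak_add_one, typeMapsStrict_eq_ncard _ a C (fun j => 1 - descentStep ω a j) hcompl, h1] at h2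
  rw [hpF, map_mul, map_pow, map_neg, map_one, MvPolynomial.eval_aeval_pair,
    MvPolynomial.eval_aeval_pair]
  simpa using h2
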